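/- Let n ≥ 2. There is no subgroup Γ of O(n,1) whose action on de Sitter space dS^n = {x ∈ ℝ^{n+1} : x₁² + ⋯ + xₙ² − x_{n+1}² = 1} is both properly discontinuous and cocompact. In particular de Sitter space admits no compact Clifford–Klein form. -/

import Mathlib

open Matrix

/-- The Lorentz form matrix `η = diag(1,…,1,−1)` on `ℝ^{n+1}`. -/
def lorentzForm (n : ℕ) : Matrix (Fin (n + 1)) (Fin (n + 1)) ℝ :=
  Matrix.diagonal (fun i => if i = Fin.last n then (-1 : ℝ) else 1)

/-- De Sitter space `dS^n = {x ∈ ℝ^{n+1} : x₁² + ⋯ + xₙ² − x_{n+1}² = 1}`. -/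
def deSitter (n : ℕ) : Set (Fin (n + 1) → ℝ) :=
  {x | (∑ i : Fin n, x i.castSucc ^ 2) - x (Fin.last n) ^ 2 = 1}

theorem mem_deSitter_iff (n : ℕ) (x : Fin (n + 1) → ℝ) :
    x ∈ deSitter n ↔ x ⬝ᵥ (lorentzForm n *ᵥ x) = 1 := by
  have h : x ⬝ᵥ (lorentzForm n *ᵥ x) =
      (∑ i : Fin n, x i.castSucc ^ 2) - x (Fin.last n) ^ 2 := by
    simp only [lorentzForm, dotProduct, Matrix.mulVec_diagonal, Fin.sum_univ_castSucc]
    simp [Fin.castSucc_ne_last, pow_two, sub_eq_add_neg]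
  rw [h]
  rfl

theorem mulVec_mem_deSitter (n : ℕ) (A : Matrix (Fin (n + 1)) (Fin (n + 1)) ℝ)
    (hA : Aᵀ * lorentzForm n * A = lorentzForm n) (x : Fin (n + 1) → ℝ) (hx : x ∈ deSitter n) :
    A *ᵥ x ∈ deSitter n := by
  rw [mem_deSitter_iff] at hx ⊢
  rw [← hx]
  conv_rhs => rw [← hA]
  rw [← Matrix.mulVec_mulVec, ← Matrix.mulVec_mulVec, Matrix.dotProduct_mulVec x Aᵀ,
    Matrix.vecMul_transpose]

/-- The equator of de Sitter space. -/
def dsEquator (n : ℕ) : Set (Fin (n + 1) → ℝ) := deSitter n ∩ {x | x (Fin.last n) = 0}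

theorem isCompact_dsEquator (n : ℕ) : IsCompact (dsEquator n) := by
  have hcl : IsClosed (dsEquator n) := by
    apply IsClosed.inter
    · exact isClosed_eq (by fun_prop) continuous_const
    · exact isClosed_eq (by fun_prop) continuous_const
  refine IsCompact.of_isClosed_subset
    (isCompact_univ_pi (fun _ : Fin (n + 1) => isCompact_Icc (a := (-1 : ℝ)) (b := 1))) hcl ?_
  rintro x ⟨hx, hl⟩ i -
  simp only [deSitter, Set.mem_ofPred_eq] at hx hl
  refine Fin.lastCases ?_ (fun j => ?_) i
  · rw [hl]; constructor <;> norm_num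
  · have := Finset.single_le_sum (f := fun i : Fin n => x i.castSucc ^ 2)
      (fun i _ => sq_nonneg _) (Finset.mem_univ j)
    rw [hl] at hx
    constructor <;> nlinarith

theorem exists_unit_perp (a b : ℝ) : ∃ c d : ℝ, c ^ 2 + d ^ 2 = 1 ∧ a * c + b * d = 0 := by
  by_cases h : a ^ 2 + b ^ 2 = 0
  · have ha : a = 0 := by nlinarith [sq_nonneg a, sq_nonneg b]
    have hb : b = 0 := by nlinarith [sq_nonneg a, sq_nonneg b]
    exact ⟨1, 0, by norm_num, by simp [ha]⟩
  · have hpos : 0 < a ^ 2 + b ^ 2 := lt_of_le_of_ne (by positivity) (Ne.symm h)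
    have hs := Real.sq_sqrt hpos.le
    have hs0 : Real.sqrt (a ^ 2 + b ^ 2) ≠ 0 := ne_of_gt (Real.sqrt_pos.mpr hpos)
    refine ⟨b / Real.sqrt (a ^ 2 + b ^ 2), -a / Real.sqrt (a ^ 2 + b ^ 2), ?_, ?_⟩
    · rw [div_pow, div_pow, hs]; field_simp; ring
    · field_simp; ring

theorem exists_equator (m : ℕ) (A : Matrix (Fin (m + 2 + 1)) (Fin (m + 2 + 1)) ℝ)
    (hA : Aᵀ * lorentzForm (m + 2) * A = lorentzForm (m + 2)) :
    ∃ x ∈ dsEquator (m + 2), A *ᵥ x ∈ dsEquator (m + 2) := by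
  obtain ⟨c, d, h1, h2⟩ := exists_unit_perp (A (Fin.last _) (Fin.castSucc 0))
    (A (Fin.last _) (Fin.castSucc 1))
  let x : Fin (m + 2 + 1) → ℝ :=
    Fin.snoc (α := fun _ => ℝ) (Fin.cons c (Fin.cons d 0) : Fin (m + 2) → ℝ) 0
  have hx : x ∈ deSitter (m + 2) := by
    simp [x, deSitter, Fin.sum_univ_succ (n := m + 1), Fin.sum_univ_succ (n := m), h1,
      -Fin.castSucc_zero, -Fin.castSucc_one, -Fin.castSucc_succ]
  refine ⟨x, ⟨hx, by simp [x]⟩, mulVec_mem_deSitter _ A hA x hx, ?_⟩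
  simp only [Set.mem_ofPred_eq, Matrix.mulVec, dotProduct]
  rw [Fin.sum_univ_castSucc, Fin.sum_univ_succ, Fin.sum_univ_succ]
  simp only [x, Fin.snoc_castSucc, Fin.snoc_last, Fin.cons_zero, Fin.cons_succ, Pi.zero_apply,
    mul_zero, Finset.sum_const_zero, add_zero]
  exact h2

/-- For `n ≥ 2`, no subgroup `Γ` of `O(n,1)` acts both properly discontinuously and
cocompactly on de Sitter space `dS^n`: de Sitter space has no compact Clifford–Klein form. -/
theorem deSitter_no_compact_form (n : ℕ) (hn : 2 ≤ n)
    (Γ : Subgroup (Matrix.GeneralLinearGroup (Fin (n + 1)) ℝ))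
    (hΓ : ∀ γ ∈ Γ, (γ : Matrix (Fin (n + 1)) (Fin (n + 1)) ℝ)ᵀ * lorentzForm n * γ = lorentzForm n) :
    ¬ ((∀ K L : Set (Fin (n + 1) → ℝ), K ⊆ deSitter n → L ⊆ deSitter n →
          IsCompact K → IsCompact L →
          {γ : Γ | ∃ x ∈ K,
            ((γ : Matrix.GeneralLinearGroup (Fin (n + 1)) ℝ) :
                Matrix (Fin (n + 1)) (Fin (n + 1)) ℝ).mulVec x ∈ L}.Finite) ∧
        (∃ K : Set (Fin (n + 1) → ℝ), K ⊆ deSitter n ∧ IsCompact K ∧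
          ∀ x ∈ deSitter n, ∃ γ ∈ Γ, ∃ y ∈ K,
            ((γ : Matrix.GeneralLinearGroup (Fin (n + 1)) ℝ) :
                Matrix (Fin (n + 1)) (Fin (n + 1)) ℝ).mulVec y = x)) := by
  rintro ⟨hpd, K, hK, hKc, hcov⟩
  obtain ⟨m, rfl⟩ : ∃ m, n = m + 2 := ⟨n - 2, by omega⟩
  have hfin := hpd (dsEquator (m + 2)) (dsEquator (m + 2)) Set.inter_subset_left
    Set.inter_subset_left (isCompact_dsEquator _) (isCompact_dsEquator _)
  have huniv : {γ : Γ | ∃ x ∈ dsEquator (m + 2),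
      ((γ : Matrix.GeneralLinearGroup (Fin (m + 2 + 1)) ℝ) :
        Matrix (Fin (m + 2 + 1)) (Fin (m + 2 + 1)) ℝ).mulVec x ∈ dsEquator (m + 2)} =
      Set.univ := by
    ext γ
    simp only [Set.mem_ofPred_eq, Set.mem_univ, iff_true]
    exact exists_equator m _ (hΓ γ γ.2)
  rw [huniv] at hfin
  have hc : IsCompact (⋃ γ ∈ (Set.univ : Set Γ),
      Set.image (fun y => ((γ : Matrix.GeneralLinearGroup (Fin (m + 2 + 1)) ℝ) :
        Matrix (Fin (m + 2 + 1)) (Fin (m + 2 + 1)) ℝ).mulVec y) K) :=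
    hfin.isCompact_biUnion fun γ _ => hKc.image (by fun_prop)
  obtain ⟨C, hC⟩ := (hc.image (continuous_apply (Fin.last (m + 2)))).bddAbove
  let t : ℝ := C + 1
  let x : Fin (m + 2 + 1) → ℝ :=
    Fin.snoc (α := fun _ => ℝ) (Fin.cons (Real.sqrt (1 + t ^ 2)) 0 : Fin (m + 2) → ℝ) t
  have hx : x ∈ deSitter (m + 2) := by
    have : Real.sqrt (1 + t ^ 2) ^ 2 = 1 + t ^ 2 := Real.sq_sqrt (by positivity)
    simp only [deSitter, Set.mem_ofPred_eq, x, Fin.snoc_castSucc, Fin.snoc_last]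
    rw [Fin.sum_univ_succ]
    simp [this]
  obtain ⟨γ, hγ, y, hy, hxy⟩ := hcov x hx
  have hle : x (Fin.last (m + 2)) ≤ C := by
    apply hC
    refine ⟨x, ?_, rfl⟩
    simp only [Set.mem_iUnion]
    exact ⟨⟨γ, hγ⟩, Set.mem_univ _, y, hy, hxy⟩
  simp only [x, Fin.snoc_last, t] at hle
  linarith
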